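/- arXiv:1112.5554 — 2 statements merged into one kernel-verified Lean document; each statement's English description precedes it below -/
import Mathlib

section
/- For any m ∈ [1,2) and any a, r > 0: e_m((ar-1)² - 1) ≥ e_m(-2/m) · e_m(a²r²/2), where e_m(τ) = [1+(m-1)τ]₊^{1/(m-1)} for m > 1 and e_1(τ) = e^τ. -/
open ENNReal

/-- The m-exponential `e_m(τ) = [1+(m-1)τ]₊^{1/(m-1)}` (with `0^a = ∞` for `a < 0`),
and `e_1 = exp`. -/
noncomputable def expm (m τ : ℝ) : ℝ≥0∞ :=
  if m = 1 then ENNReal.ofReal (Real.exp τ)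
  else if 1 < m then ENNReal.ofReal ((max (1 + (m - 1) * τ) 0) ^ (1 / (m - 1)))
  else if 1 + (m - 1) * τ ≤ 0 then ⊤
  else ENNReal.ofReal ((1 + (m - 1) * τ) ^ (1 / (m - 1)))

/-- The comparison of the bases of the two `m`-exponentials, with `y = a r`. -/
lemma expm_base_mul_le {m : ℝ} (hm : 1 ≤ m) (hm2 : m < 2) (y : ℝ) :
    (1 + (m - 1) * (-2 / m)) * (1 + (m - 1) * (y ^ 2 / 2)) ≤
      1 + (m - 1) * ((y - 1) ^ 2 - 1) := by
  have hm0 : 0 < m := by linarith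
  have key : 1 + (m - 1) * ((y - 1) ^ 2 - 1) -
      (1 + (m - 1) * (-2 / m)) * (1 + (m - 1) * (y ^ 2 / 2)) =
      (m - 1) * ((m * y - 2) ^ 2 + (2 - m) * (m - 1) * y ^ 2) / (2 * m) := by
    field_simp
    ring
  have : 0 ≤ (m - 1) * ((m * y - 2) ^ 2 + (2 - m) * (m - 1) * y ^ 2) / (2 * m) := by
    have h1 : 0 ≤ m - 1 := by linarith
    have h2 : 0 ≤ 2 - m := by linarith
    positivity
  linarith

/-- For `m ∈ [1,2)` and `a, r > 0`:
`e_m((ar-1)² - 1) ≥ e_m(-2/m)·e_m(a²r²/2)`. -/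
theorem stmt16 (m : ℝ) (hm : 1 ≤ m) (hm2 : m < 2) (a r : ℝ)
    (ha : 0 < a) (hr : 0 < r) :
    expm m (-2 / m) * expm m (a ^ 2 * r ^ 2 / 2) ≤ expm m ((a * r - 1) ^ 2 - 1) := by
  rcases hm.eq_or_lt with rfl | h1
  · simp only [expm, if_true]
    rw [← ENNReal.ofReal_mul (Real.exp_pos _).le, ← Real.exp_add]
    refine ENNReal.ofReal_le_ofReal (Real.exp_le_exp.2 ?_)
    nlinarith [sq_nonneg (a * r - 2)]
  · simp only [expm, if_neg h1.ne', if_pos h1]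
    rw [← ENNReal.ofReal_mul (by positivity),
      ← Real.mul_rpow (le_max_right _ _) (le_max_right _ _)]
    have hk : 0 < m - 1 := by linarith
    refine ENNReal.ofReal_le_ofReal (Real.rpow_le_rpow (by positivity) ?_ (by positivity))
    have hA : 0 ≤ 1 + (m - 1) * (-2 / m) := by
      have : 1 + (m - 1) * (-2 / m) = (2 - m) / m := by
        field_simp
        ring
      rw [this]
      exact div_nonneg (by linarith) (by linarith)
    rw [max_eq_left hA, max_eq_left (by positivity), ← mul_pow]
    exact (expm_base_mul_le hm hm2 (a * r)).trans (le_max_left _ _)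
end

section
/- Let (X,ω) be a compact metric measure space with ω a finite Borel measure, and let h:[0,∞)→ℝ be continuous and convex with h(0)=0. Set h'(∞)=lim_{r→∞}h(r)/r, and for a Borel probability measure μ with Lebesgue decomposition μ = (dμ/dω)·ω + μ^s define H(μ) = ∫_X h(dμ/dω) dω + h'(∞)·μ^s[X]. Then H is weakly lower semicontinuous on probability measures: if a sequence μ_i of Borel probability measures converges weakly to μ, then H(μ) ≤ liminf_{i→∞} H(μ_i). -/
open MeasureTheory Filter Set ENNReal

/-- The extended-real-valued internal energy
`U_ω(ν) = ∫ h(dν/dω) dω + h'(∞)·νˢ(X)`, where `ν = (dν/dω)·ω + νˢ` is the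
Lebesgue decomposition of `ν` with respect to `ω`; the (possibly `+∞`-valued)
integral is encoded as the difference of the lower integrals of the positive and
negative parts of `h(dν/dω)` (the latter is finite in the situation considered). -/
noncomputable def Uomega {X : Type*} [MeasurableSpace X]
    (ω : Measure X) (h : ℝ → ℝ) (hInf : EReal) (ν : Measure X) : EReal :=
  ((∫⁻ x, ENNReal.ofReal (h ((ν.rnDeriv ω x).toReal)) ∂ω : ℝ≥0∞) : EReal)
    - ((∫⁻ x, ENNReal.ofReal (-(h ((ν.rnDeriv ω x).toReal))) ∂ω : ℝ≥0∞) : EReal)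
    + hInf * ((ν.singularPart ω) Set.univ : ℝ≥0∞)

lemma exists_affine_family_of_convexOn {s : Set ℝ} {h : ℝ → ℝ} (hs : IsClosed s)
    (hc : ContinuousOn h s) (hconv : ConvexOn ℝ s h) :
    ∃ a b : ℕ → ℝ, (∀ k, ∀ r ∈ s, a k * r + b k ≤ h r) ∧
      ∀ r ∈ s, ∀ y < h r, ∃ k, y < a k * r + b k := by
  obtain ⟨l, c, hle, hsup⟩ := hconv.real_sSup_of_nat_affine_eq hs hc.lowerSemicontinuousOn
  have hl (k : ℕ) (r : ℝ) : l k 1 * r = l k r := by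
    rw [mul_comm, ← smul_eq_mul, ← map_smul, smul_eq_mul, mul_one]
  refine ⟨fun k => l k 1, c, fun k r hr => ?_, fun r hr y hy => ?_⟩
  · simpa [hl] using hle k ⟨r, hr⟩
  · have hr' := congrFun hsup ⟨r, hr⟩
    rw [iSup_apply] at hr'
    obtain ⟨k, hk⟩ := exists_lt_of_lt_ciSup (hy.trans_eq hr'.symm)
    exact ⟨k, by simpa [hl] using hk⟩

lemma coe_slope_le_of_affine_le {h : ℝ → ℝ} {c : EReal} {a b : ℝ}
    (hlim : Tendsto (fun r : ℝ => ((h r / r : ℝ) : EReal)) atTop (nhds c))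
    (hab : ∀ r, 0 ≤ r → a * r + b ≤ h r) : (a : EReal) ≤ c := by
  have h1 : Tendsto (fun r : ℝ => a + b / r) atTop (nhds (a + 0)) :=
    tendsto_const_nhds.add (tendsto_id.const_div_atTop b)
  rw [add_zero] at h1
  refine le_of_tendsto_of_tendsto ((continuous_coe_real_ereal.tendsto a).comp h1) hlim ?_
  filter_upwards [eventually_gt_atTop 0] with r hr
  simp only [Function.comp_apply, EReal.coe_le_coe_iff]
  rw [le_div_iff₀ hr, add_mul, div_mul_cancel₀ _ hr.ne']
  exact hab r hr.le

lemma exists_lt_coe_slope {h : ℝ → ℝ} {c : EReal} {a b : ℕ → ℝ}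
    (hlim : Tendsto (fun r : ℝ => ((h r / r : ℝ) : EReal)) atTop (nhds c))
    (hle : ∀ k r, 0 ≤ r → a k * r + b k ≤ h r)
    (hsup : ∀ r, 0 ≤ r → ∀ y < h r, ∃ k, y < a k * r + b k)
    {y : ℝ} (hy : (y : EReal) < c) : ∃ k, y < a k := by
  by_contra! hcon
  refine hy.not_ge ?_
  have h1 : Tendsto (fun r : ℝ => y + h 0 / r) atTop (nhds (y + 0)) :=
    tendsto_const_nhds.add (tendsto_id.const_div_atTop (h 0))
  rw [add_zero] at h1
  refine le_of_tendsto_of_tendsto hlim ((continuous_coe_real_ereal.tendsto y).comp h1) ?_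
  filter_upwards [eventually_gt_atTop 0] with r hr
  simp only [Function.comp_apply, EReal.coe_le_coe_iff]
  rw [div_le_iff₀ hr, add_mul, div_mul_cancel₀ _ hr.ne']
  by_contra! hlt
  obtain ⟨k, hk⟩ := hsup r hr.le _ hlt
  have h2 := hle k 0 le_rfl
  have h3 := mul_le_mul_of_nonneg_right (hcon k) hr.le
  linarith

/-- The integral against `ν` of a continuous function on a compact space, split along the
Lebesgue decomposition of `ν` with respect to `ω`. -/
lemma integral_eq_integral_rnDeriv_add_integral_singularPart {X : Type*} [MeasurableSpace X]
    [TopologicalSpace X] [CompactSpace X] [OpensMeasurableSpace X]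
    (ν ω : Measure X) [IsFiniteMeasure ν] [IsFiniteMeasure ω] (f : C(X, ℝ)) :
    Integrable (fun x => f x * (ν.rnDeriv ω x).toReal) ω ∧
    ∫ x, f x ∂ν = ∫ x, f x * (ν.rnDeriv ω x).toReal ∂ω + ∫ x, f x ∂(ν.singularPart ω) := by
  have hint (κ : Measure X) [IsFiniteMeasure κ] : Integrable f κ :=
    (BoundedContinuousFunction.mkOfCompact f).integrable κ
  refine ⟨?_, ?_⟩
  · have := (integrable_withDensity_iff_integrable_smul' (Measure.measurable_rnDeriv ν ω)
      (Measure.rnDeriv_lt_top ν ω)).1 (hint (ω.withDensity (ν.rnDeriv ω)))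
    simpa [mul_comm] using this
  · conv_lhs => rw [Measure.haveLebesgueDecomposition_add ν ω]
    rw [integral_add_measure (hint _) (hint _),
      integral_withDensity_eq_integral_toReal_smul (Measure.measurable_rnDeriv ν ω)
        (Measure.rnDeriv_lt_top ν ω), add_comm]
    simp [mul_comm]

lemma ofReal_integral_le_lintegral_ofReal {X : Type*} [MeasurableSpace X] {μ : Measure X}
    {u : X → ℝ} (hu : Integrable u μ) :
    ENNReal.ofReal (∫ x, u x ∂μ) ≤ ∫⁻ x, ENNReal.ofReal (u x) ∂μ := by
  calc ENNReal.ofReal (∫ x, u x ∂μ) ≤ ENNReal.ofReal (∫ x, max (u x) 0 ∂μ) :=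
        ENNReal.ofReal_le_ofReal
          (integral_mono hu hu.pos_part fun x => le_max_left _ _)
    _ = ∫⁻ x, ENNReal.ofReal (max (u x) 0) ∂μ :=
        ofReal_integral_eq_lintegral_ofReal hu.pos_part (ae_of_all _ fun x => le_max_right _ _)
    _ = _ := by simp [ENNReal.ofReal_max]

/-- Duality, easy inequality: continuous fields of affine minorants of `h` bound the
internal energy from below. -/
lemma ofReal_integral_add_integral_le {X : Type*} [MeasurableSpace X]
    [TopologicalSpace X] [CompactSpace X] [OpensMeasurableSpace X]
    (ν ω : Measure X) [IsFiniteMeasure ν] [IsFiniteMeasure ω] {h : ℝ → ℝ} {c : EReal}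
    (hlim : Tendsto (fun r : ℝ => ((h r / r : ℝ) : EReal)) atTop (nhds c))
    (f g : C(X, ℝ)) (hfg : ∀ x r, 0 ≤ r → f x * r + g x ≤ h r) :
    ENNReal.ofReal (∫ x, f x ∂ν + ∫ x, g x ∂ω) ≤
      ∫⁻ x, ENNReal.ofReal (h (ν.rnDeriv ω x).toReal) ∂ω +
        c.toENNReal * ν.singularPart ω univ := by
  obtain ⟨hfi, hfe⟩ := integral_eq_integral_rnDeriv_add_integral_singularPart ν ω f
  have hg : Integrable g ω := (BoundedContinuousFunction.mkOfCompact g).integrable ω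
  have hf : Integrable f (ν.singularPart ω) :=
    (BoundedContinuousFunction.mkOfCompact f).integrable _
  rw [hfe, add_right_comm, ← integral_add hfi hg]
  refine ENNReal.ofReal_add_le.trans (add_le_add ?_ ?_)
  · refine (ofReal_integral_le_lintegral_ofReal (hfi.add hg)).trans (lintegral_mono fun x => ?_)
    exact ENNReal.ofReal_le_ofReal (hfg x _ ENNReal.toReal_nonneg)
  · refine (ofReal_integral_le_lintegral_ofReal hf).trans ?_
    rw [← lintegral_const]
    refine lintegral_mono fun x => ?_
    rw [← EReal.real_coe_toENNReal]
    exact EReal.toENNReal_le_toENNReal (coe_slope_le_of_affine_le hlim (hfg x))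

/-- If the integrable function `q` is `L¹`-close to `F`, then `max q p` is `L¹`-close to
an interpolation of `F` and `p` by a continuous cutoff function. -/
lemma exists_cutoff_lintegral_enorm_max_sub_lt {X : Type*} [MeasurableSpace X]
    [MetricSpace X] [BorelSpace X] (lam : Measure X) [IsFiniteMeasure lam]
    {q p F : X → ℝ} (hqm : Measurable q) (hpm : Measurable p) (hFm : Measurable F)
    (hq : Integrable q lam) (hp : Integrable p lam)
    {ε : ℝ≥0∞} (hε : ∫⁻ x, ‖q x - F x‖ₑ ∂lam < ε) :
    ∃ φ : C(X, ℝ), (∀ x, φ x ∈ Icc (0 : ℝ) 1) ∧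
      ∫⁻ x, ‖max (q x) (p x) - ((1 - φ x) * F x + φ x * p x)‖ₑ ∂lam < ε := by
  set κ := lam.withDensity (fun x => ‖q x - p x‖ₑ) with hκ
  have : IsFiniteMeasure κ := isFiniteMeasure_withDensity (hq.sub hp).2.ne
  have hA : MeasurableSet {x | q x < p x} := measurableSet_lt hqm hpm
  set A := {x | q x < p x}
  have hδ : (ε - ∫⁻ x, ‖q x - F x‖ₑ ∂lam) / 2 ≠ 0 := by
    simpa [tsub_eq_zero_iff_le] using hε
  obtain ⟨C, hCA, hC, hC'⟩ := hA.exists_isClosed_sdiff_lt (measure_ne_top κ A) hδ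
  obtain ⟨G, hAG, hG, -, hG'⟩ := hA.exists_isOpen_sdiff_lt (measure_ne_top κ A) hδ
  obtain ⟨φ, hφ0, hφ1, hφ⟩ := exists_continuous_zero_one_of_isClosed hG.isClosed_compl hC
    (disjoint_compl_left_iff_subset.2 (hCA.trans hAG))
  refine ⟨φ, hφ, ?_⟩
  have hGC : MeasurableSet (G \ C) := hG.measurableSet.diff hC.measurableSet
  have hpt (x : X) : ‖max (q x) (p x) - ((1 - φ x) * F x + φ x * p x)‖ₑ ≤
      ‖q x - F x‖ₑ + (G \ C).indicator (fun x => ‖q x - p x‖ₑ) x := by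
    obtain ⟨h0, h1⟩ := hφ x
    by_cases hxC : x ∈ C
    · have h2 : φ x = 1 := hφ1 hxC
      have h3 : q x < p x := hCA hxC
      simp [h2, max_eq_right h3.le]
    by_cases hxG : x ∈ G
    · have hx : x ∈ G \ C := ⟨hxG, hxC⟩
      rw [indicator_of_mem hx]
      simp only [Real.enorm_eq_ofReal_abs]
      rw [← ENNReal.ofReal_add (abs_nonneg _) (abs_nonneg _)]
      refine ENNReal.ofReal_le_ofReal ?_
      rcases le_total (q x) (p x) with hqp | hqp
      · rw [max_eq_right hqp]
        calc |p x - ((1 - φ x) * F x + φ x * p x)|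
            = |(1 - φ x) * ((q x - F x) - (q x - p x))| := by ring_nf
          _ ≤ 1 * |(q x - F x) - (q x - p x)| := by
            rw [abs_mul]
            gcongr
            rw [abs_le]; constructor <;> linarith
          _ ≤ _ := by rw [one_mul]; exact abs_sub _ _
      · rw [max_eq_left hqp]
        calc |q x - ((1 - φ x) * F x + φ x * p x)|
            = |(1 - φ x) * (q x - F x) + φ x * (q x - p x)| := by ring_nf
          _ ≤ |1 - φ x| * |q x - F x| + |φ x| * |q x - p x| := by
            rw [← abs_mul, ← abs_mul]; exact abs_add_le _ _
          _ ≤ 1 * |q x - F x| + 1 * |q x - p x| := by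
            gcongr <;> rw [abs_le] <;> constructor <;> linarith
          _ = _ := by ring
    · have h2 : φ x = 0 := hφ0 hxG
      have h3 : p x ≤ q x := not_lt.1 fun h => hxG (hAG h)
      simp [h2, max_eq_left h3]
  have hsplit : G \ C ⊆ (A \ C) ∪ (G \ A) := by
    intro x hx
    by_cases hxA : x ∈ A
    · exact Or.inl ⟨hxA, hx.2⟩
    · exact Or.inr ⟨hx.1, hxA⟩
  calc ∫⁻ x, ‖max (q x) (p x) - ((1 - φ x) * F x + φ x * p x)‖ₑ ∂lam
      ≤ ∫⁻ x, (‖q x - F x‖ₑ + (G \ C).indicator (fun x => ‖q x - p x‖ₑ) x) ∂lam :=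
        lintegral_mono hpt
    _ = ∫⁻ x, ‖q x - F x‖ₑ ∂lam + κ (G \ C) := by
        have hqF : Measurable fun x => ‖q x - F x‖ₑ := (hqm.sub hFm).enorm
        rw [lintegral_add_left hqF, lintegral_indicator hGC, hκ,
          withDensity_apply _ hGC]
    _ < ∫⁻ x, ‖q x - F x‖ₑ ∂lam + ((ε - ∫⁻ x, ‖q x - F x‖ₑ ∂lam) / 2
          + (ε - ∫⁻ x, ‖q x - F x‖ₑ ∂lam) / 2) := by
        refine ENNReal.add_lt_add_left hε.ne_top ?_
        exact ((measure_mono hsplit).trans (measure_union_le _ _)).trans_lt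
          (ENNReal.add_lt_add hC' hG')
    _ = ε := by rw [ENNReal.add_halves, add_tsub_cancel_of_le hε.le]

/-- The running maximum of `0` and the first `n` functions of a sequence. -/
def runningMax {X : Type*} (p : ℕ → X → ℝ) : ℕ → X → ℝ
  | 0 => 0
  | n + 1 => fun x => max (runningMax p n x) (p n x)

lemma runningMax_monotone {X : Type*} (p : ℕ → X → ℝ) : Monotone (runningMax p) :=
  monotone_nat_of_le_succ fun _ _ => le_max_left _ _

lemma runningMax_nonneg {X : Type*} (p : ℕ → X → ℝ) (n : ℕ) (x : X) : 0 ≤ runningMax p n x :=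
  runningMax_monotone p n.zero_le x

lemma le_runningMax_succ {X : Type*} (p : ℕ → X → ℝ) (n : ℕ) (x : X) :
    p n x ≤ runningMax p (n + 1) x :=
  le_max_right _ _

lemma measurable_runningMax {X : Type*} [MeasurableSpace X] {p : ℕ → X → ℝ}
    (hp : ∀ n, Measurable (p n)) (n : ℕ) : Measurable (runningMax p n) := by
  induction n with
  | zero => exact measurable_const
  | succ n ih => exact ih.max (hp n)

lemma integrable_runningMax {X : Type*} [MeasurableSpace X] {μ : Measure X} {p : ℕ → X → ℝ}
    (hp : ∀ n, Integrable (p n) μ) (n : ℕ) : Integrable (runningMax p n) μ := by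
  induction n with
  | zero => exact integrable_zero _ _ _
  | succ n ih => exact ih.sup (hp n)

/-- A running maximum of functions `a k * m + b k * w` is approximated in `L¹` by functions
`f * m + g * w`, where `(f, g)` is continuous with values in a given convex set containing the
origin and all the pairs `(a k, b k)`. -/
lemma exists_continuous_lintegral_enorm_runningMax_sub_lt {X : Type*} [MeasurableSpace X]
    [MetricSpace X] [BorelSpace X] (lam : Measure X) [IsFiniteMeasure lam]
    {K : Set (ℝ × ℝ)} (hK : Convex ℝ K) (hK0 : (0, 0) ∈ K) {a b : ℕ → ℝ}
    (hab : ∀ k, (a k, b k) ∈ K) {m w : X → ℝ} (hmm : Measurable m) (hwm : Measurable w)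
    (hm : Integrable m lam) (hw : Integrable w lam) {ε : ℝ≥0∞} (hε : ε ≠ 0) (n : ℕ) :
    ∃ f g : C(X, ℝ), (∀ x, (f x, g x) ∈ K) ∧
      ∫⁻ x, ‖runningMax (fun k x => a k * m x + b k * w x) n x
        - (f x * m x + g x * w x)‖ₑ ∂lam < ε := by
  have hpm (k : ℕ) : Measurable (fun x => a k * m x + b k * w x) :=
    (hmm.const_mul _).add (hwm.const_mul _)
  have hpi (k : ℕ) : Integrable (fun x => a k * m x + b k * w x) lam :=
    (hm.const_mul _).add (hw.const_mul _)
  induction n with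
  | zero => exact ⟨0, 0, fun _ => hK0, by simpa [runningMax] using pos_iff_ne_zero.2 hε⟩
  | succ n ih =>
    obtain ⟨f, g, hfg, hlt⟩ := ih
    obtain ⟨φ, hφ, hlt'⟩ := exists_cutoff_lintegral_enorm_max_sub_lt lam
      (measurable_runningMax hpm n) (hpm n)
      ((f.continuous.measurable.mul hmm).add (g.continuous.measurable.mul hwm))
      (integrable_runningMax hpi n) (hpi n) hlt
    refine ⟨(1 - φ) * f + φ * ContinuousMap.const X (a n),
      (1 - φ) * g + φ * ContinuousMap.const X (b n), fun x => ?_, ?_⟩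
    · have := hK (hfg x) (hab n) (sub_nonneg.2 (hφ x).2) (hφ x).1 (sub_add_cancel _ _)
      simpa using this
    · refine lt_of_eq_of_lt (lintegral_congr fun x => ?_) hlt'
      congr 1
      simp only [runningMax, ContinuousMap.add_apply, ContinuousMap.mul_apply,
        ContinuousMap.sub_apply, ContinuousMap.one_apply, ContinuousMap.const_apply, Pi.add_apply,
        Pi.mul_apply]
      ring

/-- Duality, hard inequality: the internal energy is approximated from below by continuous fields
of affine minorants of `h`. -/
lemma exists_lt_ofReal_integral_add_integral {X : Type*} [MeasurableSpace X]
    [MetricSpace X] [CompactSpace X] [BorelSpace X]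
    (ν ω : Measure X) [IsFiniteMeasure ν] [IsFiniteMeasure ω] {h : ℝ → ℝ} {c : EReal}
    (hc : ContinuousOn h (Ici 0)) (hconv : ConvexOn ℝ (Ici 0) h)
    (hnonneg : ∀ r, 0 ≤ r → 0 ≤ h r)
    (hlim : Tendsto (fun r : ℝ => ((h r / r : ℝ) : EReal)) atTop (nhds c)) {M : ℝ≥0∞}
    (hM : M < ∫⁻ x, ENNReal.ofReal (h (ν.rnDeriv ω x).toReal) ∂ω +
        c.toENNReal * ν.singularPart ω univ) :
    ∃ f g : C(X, ℝ), (∀ x r, 0 ≤ r → f x * r + g x ≤ h r) ∧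
      M < ENNReal.ofReal (∫ x, f x ∂ν + ∫ x, g x ∂ω) := by
  classical
  obtain ⟨a, b, hle, hsup⟩ := exists_affine_family_of_convexOn isClosed_Ici hc hconv
  obtain ⟨S, hS, hνS, hωS⟩ := Measure.mutuallySingular_singularPart ν ω
  set σ := ν.singularPart ω
  have hωae : ∀ᵐ x ∂ω, x ∈ S := by rwa [ae_iff]
  have hσae : ∀ᵐ x ∂σ, x ∉ S := by rw [ae_iff]; simpa using hνS
  set ρ : X → ℝ := fun x => (ν.rnDeriv ω x).toReal
  have hρm : Measurable ρ := (Measure.measurable_rnDeriv ν ω).ennreal_toReal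
  set m : X → ℝ := S.piecewise ρ 1 with hmdef
  set w : X → ℝ := S.piecewise 1 0 with hwdef
  have hmm : Measurable m := hρm.piecewise hS measurable_one
  have hwm : Measurable w := measurable_one.piecewise hS measurable_zero
  have hmω : m =ᵐ[ω] ρ := by
    filter_upwards [hωae] with x hx using by simp [hmdef, hx]
  have hwω : w =ᵐ[ω] 1 := by
    filter_upwards [hωae] with x hx using by simp [hwdef, hx]
  have hmσ : m =ᵐ[σ] 1 := by
    filter_upwards [hσae] with x hx using by simp [hmdef, hx]
  have hwσ : w =ᵐ[σ] 0 := by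
    filter_upwards [hσae] with x hx using by simp [hwdef, hx]
  have hρi : Integrable ρ ω := Measure.integrable_toReal_rnDeriv
  have hm : Integrable m (ω + σ) :=
    (hρi.congr hmω.symm).add_measure ((integrable_const (1 : ℝ)).congr hmσ.symm)
  have hw : Integrable w (ω + σ) :=
    ((integrable_const (1 : ℝ)).congr hwω.symm).add_measure
      ((integrable_const (0 : ℝ)).congr hwσ.symm)
  set p : ℕ → X → ℝ := fun k x => a k * m x + b k * w x with hp
  have hpm (k : ℕ) : Measurable (p k) := (hmm.const_mul _).add (hwm.const_mul _)
  have hpi (k : ℕ) : Integrable (p k) (ω + σ) := (hm.const_mul _).add (hw.const_mul _)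
  have hle_iSup (x : X) (k : ℕ) :
      ENNReal.ofReal (p k x) ≤ ⨆ n, ENNReal.ofReal (runningMax p n x) :=
    (ENNReal.ofReal_le_ofReal (le_runningMax_succ p k x)).trans
      (le_iSup (fun n => ENNReal.ofReal (runningMax p n x)) (k + 1))
  have hmain : M < ⨆ n, ∫⁻ x, ENNReal.ofReal (runningMax p n x) ∂(ω + σ) := by
    rw [← lintegral_iSup (fun n => (measurable_runningMax hpm n).ennreal_ofReal)
      (fun i j hij x => ENNReal.ofReal_le_ofReal (runningMax_monotone p hij x)),
      lintegral_add_measure]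
    refine hM.trans_le (add_le_add (lintegral_mono_ae ?_) ?_)
    · filter_upwards [hωae] with x hx
      refine le_of_forall_lt fun y hy => ?_
      have hy' : y ≠ ⊤ := hy.ne_top
      obtain ⟨k, hk⟩ := hsup (ρ x) ENNReal.toReal_nonneg y.toReal
        ((ENNReal.lt_ofReal_iff_toReal_lt hy').1 hy)
      refine lt_of_lt_of_le ?_ (hle_iSup x k)
      rw [ENNReal.lt_ofReal_iff_toReal_lt hy']
      simpa [hp, hmdef, hwdef, hx] using hk
    · rw [← lintegral_const]
      refine lintegral_mono_ae ?_
      filter_upwards [hσae] with x hx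
      refine le_of_forall_lt fun y hy => ?_
      have hy' : y ≠ ⊤ := hy.ne_top
      have hyc : ((y.toReal : ℝ) : EReal) < c := by
        rw [EReal.coe_ennreal_toReal hy']
        have hc0 : 0 < c := by
          rw [← EReal.toENNReal_pos_iff]; exact bot_le.trans_lt hy
        rwa [← EReal.coe_toENNReal hc0.le, EReal.coe_ennreal_lt_coe_ennreal_iff]
      obtain ⟨k, hk⟩ := exists_lt_coe_slope hlim hle hsup hyc
      refine lt_of_lt_of_le ?_ (hle_iSup x k)
      rw [ENNReal.lt_ofReal_iff_toReal_lt hy']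
      simpa [hp, hmdef, hwdef, hx] using hk
  obtain ⟨n, hn⟩ := lt_iSup_iff.1 hmain
  set K : Set (ℝ × ℝ) := {z | ∀ r, 0 ≤ r → z.1 * r + z.2 ≤ h r}
  have hK : Convex ℝ K := by
    intro y hy z hz s t hs ht hst r hr
    have h1 := mul_le_mul_of_nonneg_left (hy r hr) hs
    have h2 := mul_le_mul_of_nonneg_left (hz r hr) ht
    have h3 : h r = s * h r + t * h r := by rw [← add_mul, hst, one_mul]
    simp only [Prod.fst_add, Prod.snd_add, Prod.smul_fst, Prod.smul_snd, smul_eq_mul]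
    rw [h3]
    linarith
  have hK0 : ((0 : ℝ), (0 : ℝ)) ∈ K := fun r hr => by simpa using hnonneg r hr
  obtain ⟨f, g, hfg, hlt⟩ := exists_continuous_lintegral_enorm_runningMax_sub_lt (ω + σ) hK hK0
    hle hmm hwm hm hw (tsub_pos_of_lt hn).ne' n
  refine ⟨f, g, hfg, ?_⟩
  obtain ⟨hfi, hfe⟩ := integral_eq_integral_rnDeriv_add_integral_singularPart ν ω f
  have hg : Integrable g ω := (BoundedContinuousFunction.mkOfCompact g).integrable ω
  have hf : Integrable f σ := (BoundedContinuousFunction.mkOfCompact f).integrable σ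
  have hFω : (fun x => f x * m x + g x * w x) =ᵐ[ω] fun x => f x * ρ x + g x := by
    filter_upwards [hmω, hwω] with x h1 h2 using by simp [h1, h2]
  have hFσ : (fun x => f x * m x + g x * w x) =ᵐ[σ] f := by
    filter_upwards [hmσ, hwσ] with x h1 h2 using by simp [h1, h2]
  have hFi1 := (hfi.add hg).congr hFω.symm
  have hFi2 := hf.congr hFσ.symm
  have hFi : Integrable (fun x => f x * m x + g x * w x) (ω + σ) := hFi1.add_measure hFi2
  have hF : ∫ x, f x ∂ν + ∫ x, g x ∂ω = ∫ x, f x * m x + g x * w x ∂(ω + σ) := by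
    rw [integral_add_measure hFi1 hFi2, integral_congr_ae hFω, integral_congr_ae hFσ,
      integral_add hfi hg, hfe]
    ring
  rw [hF]
  have hqi := integrable_runningMax hpi n
  have hbound : ∫⁻ x, ENNReal.ofReal (runningMax p n x) ∂(ω + σ) ≤
      ENNReal.ofReal (∫ x, f x * m x + g x * w x ∂(ω + σ)) +
        ∫⁻ x, ‖runningMax p n x - (f x * m x + g x * w x)‖ₑ ∂(ω + σ) := by
    rw [← ofReal_integral_eq_lintegral_ofReal hqi (ae_of_all _ (runningMax_nonneg p n)),
      ← ofReal_integral_norm_eq_lintegral_enorm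
        (f := fun x => runningMax p n x - (f x * m x + g x * w x)) (hqi.sub hFi)]
    refine le_trans (ENNReal.ofReal_le_ofReal ?_) ENNReal.ofReal_add_le
    have hd : Integrable (fun x => ‖runningMax p n x - (f x * m x + g x * w x)‖) (ω + σ) :=
      (hqi.sub hFi).norm
    rw [← integral_add hFi hd]
    refine integral_mono hqi (hFi.add hd) fun x => ?_
    have := Real.le_norm_self (runningMax p n x - (f x * m x + g x * w x))
    change _ ≤ _ + ‖_‖
    linarith
  by_contra! hcon
  refine (hbound.trans (add_le_add_left hcon _)).not_gt ?_
  calc _ < M + (∫⁻ x, ENNReal.ofReal (runningMax p n x) ∂(ω + σ) - M) :=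
        ENNReal.add_lt_add_left hn.ne_top hlt
    _ = _ := add_tsub_cancel_of_le hn.le

/-- Lower semicontinuity of the internal energy of a nonnegative convex function. -/
lemma lintegral_add_singularPart_le_liminf {X : Type*} [MeasurableSpace X]
    [MetricSpace X] [CompactSpace X] [BorelSpace X]
    (ω : Measure X) [IsFiniteMeasure ω] {h : ℝ → ℝ} {c : EReal}
    (hc : ContinuousOn h (Ici 0)) (hconv : ConvexOn ℝ (Ici 0) h)
    (hnonneg : ∀ r, 0 ≤ r → 0 ≤ h r)
    (hlim : Tendsto (fun r : ℝ => ((h r / r : ℝ) : EReal)) atTop (nhds c))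
    {ι : Type*} {l : Filter ι} {μ : ProbabilityMeasure X} {μs : ι → ProbabilityMeasure X}
    (hweak : Tendsto μs l (nhds μ)) :
    ∫⁻ x, ENNReal.ofReal (h ((μ : Measure X).rnDeriv ω x).toReal) ∂ω +
        c.toENNReal * (μ : Measure X).singularPart ω univ ≤
      liminf (fun i => ∫⁻ x, ENNReal.ofReal (h ((μs i : Measure X).rnDeriv ω x).toReal) ∂ω +
        c.toENNReal * (μs i : Measure X).singularPart ω univ) l := by
  rw [le_liminf_iff]
  intro M hM
  obtain ⟨f, g, hfg, hlt⟩ :=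
    exists_lt_ofReal_integral_add_integral (μ : Measure X) ω hc hconv hnonneg hlim hM
  have hf := ProbabilityMeasure.tendsto_iff_forall_integral_tendsto.1 hweak
    (BoundedContinuousFunction.mkOfCompact f)
  have hconv' := (ENNReal.continuous_ofReal.tendsto _).comp (hf.add_const (∫ x, g x ∂ω))
  filter_upwards [hconv'.eventually (lt_mem_nhds hlt)] with i hi
  exact lt_of_lt_of_le hi (ofReal_integral_add_integral_le _ ω hlim f g hfg)

lemma EReal.coe_sub_coe_eq_add_of_add_eq {P N Lp Ln Q : ℝ≥0∞} (hN : N ≠ ⊤) (hLp : Lp ≠ ⊤)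
    (hLn : Ln ≠ ⊤) (h : P + Ln = N + Lp + Q) :
    (P : EReal) - N = Q + ((Lp.toReal - Ln.toReal : ℝ) : EReal) := by
  lift N to NNReal using hN
  lift Lp to NNReal using hLp
  lift Ln to NNReal using hLn
  induction Q with
  | top =>
    have hP : P = ⊤ := by simpa using h
    subst hP
    simp only [EReal.coe_ennreal_top, EReal.top_add_coe]
    exact EReal.top_sub_coe N
  | coe Q =>
    have hP : P ≠ ⊤ := by
      rintro rfl
      simp [← ENNReal.coe_add] at h
    lift P to NNReal using hP
    norm_cast at h
    have h' : (P : ℝ) + Ln = N + Lp + Q := by exact_mod_cast h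
    change ((P : ℝ) : EReal) - ((N : ℝ) : EReal) = ((Q : ℝ) : EReal) + _
    rw [← EReal.coe_sub, ← EReal.coe_add, EReal.coe_eq_coe_iff]
    simp only [ENNReal.coe_toReal]
    linarith

lemma lintegral_pos_part_sub_neg_part_eq {X : Type*} [MeasurableSpace X] {ω : Measure X}
    {u ℓ : X → ℝ} (hu : Measurable u) (hℓm : Measurable ℓ) (hℓ : Integrable ℓ ω)
    (hle : ∀ x, ℓ x ≤ u x) :
    ((∫⁻ x, ENNReal.ofReal (u x) ∂ω : ℝ≥0∞) : EReal)
      - ((∫⁻ x, ENNReal.ofReal (-u x) ∂ω : ℝ≥0∞) : EReal)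
      = ((∫⁻ x, ENNReal.ofReal (u x - ℓ x) ∂ω : ℝ≥0∞) : EReal)
        + ((∫ x, ℓ x ∂ω : ℝ) : EReal) := by
  have hLp : ∫⁻ x, ENNReal.ofReal (ℓ x) ∂ω ≠ ⊤ := hℓ.lintegral_lt_top.ne
  have hLn : ∫⁻ x, ENNReal.ofReal (-ℓ x) ∂ω ≠ ⊤ := hℓ.neg.lintegral_lt_top.ne
  have hN : ∫⁻ x, ENNReal.ofReal (-u x) ∂ω ≠ ⊤ :=
    ne_top_of_le_ne_top hLn (lintegral_mono fun x =>
      ENNReal.ofReal_le_ofReal (neg_le_neg (hle x)))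
  rw [integral_eq_lintegral_pos_part_sub_lintegral_neg_part hℓ]
  refine EReal.coe_sub_coe_eq_add_of_add_eq hN hLp hLn ?_
  have hum : Measurable fun x => ENNReal.ofReal (-u x) := hu.neg.ennreal_ofReal
  have hsum : Measurable fun x => ENNReal.ofReal (-u x) + ENNReal.ofReal (ℓ x) :=
    hum.add hℓm.ennreal_ofReal
  rw [← lintegral_add_left hu.ennreal_ofReal, ← lintegral_add_left hum, ← lintegral_add_left hsum]
  refine lintegral_congr fun x => ?_
  have hx := hle x
  have hmax (t : ℝ) : ENNReal.ofReal t = ENNReal.ofReal (max t 0) := by simp [ENNReal.ofReal_max]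
  simp only [hmax (u x), hmax (-u x), hmax (ℓ x), hmax (-ℓ x), hmax (u x - ℓ x)]
  rw [← ENNReal.ofReal_add (by positivity) (by positivity),
    ← ENNReal.ofReal_add (by positivity) (by positivity),
    ← ENNReal.ofReal_add (by positivity) (by positivity)]
  congr 1
  grind

/-- Subtracting an affine minorant from `h` changes the internal energy of probability measures
by a constant. -/
lemma Uomega_eq_add_coe {X : Type*} [MeasurableSpace X] (ω ν : Measure X) [IsFiniteMeasure ω]
    [IsProbabilityMeasure ν] {h : ℝ → ℝ} (hc : ContinuousOn h (Ici 0)) {c : EReal} {a b : ℝ}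
    (hc0 : 0 ≤ c) (hab : ∀ r, 0 ≤ r → a * r + b ≤ h r) :
    Uomega ω h (c + a) ν =
      ((∫⁻ x, ENNReal.ofReal (h (ν.rnDeriv ω x).toReal - (a * (ν.rnDeriv ω x).toReal + b)) ∂ω +
        c.toENNReal * ν.singularPart ω univ : ℝ≥0∞) : EReal) +
          ((a + b * ω.real univ : ℝ) : EReal) := by
  have hρm : Measurable fun x => (ν.rnDeriv ω x).toReal :=
    (Measure.measurable_rnDeriv ν ω).ennreal_toReal
  have hρi : Integrable (fun x => (ν.rnDeriv ω x).toReal) ω := Measure.integrable_toReal_rnDeriv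
  have hu : Measurable fun x => h (ν.rnDeriv ω x).toReal := by
    have h1 : Continuous fun r => h (max r 0) :=
      hc.comp_continuous (by fun_prop) fun r => mem_Ici.2 (le_max_right _ _)
    simpa [Function.comp_def] using h1.measurable.comp hρm
  have hlin := lintegral_pos_part_sub_neg_part_eq (ω := ω) hu ((hρm.const_mul a).add_const b)
    ((hρi.const_mul a).add (integrable_const b)) fun x => hab _ ENNReal.toReal_nonneg
  have hℓ : ∫ x, a * (ν.rnDeriv ω x).toReal + b ∂ω
      = a * (1 - (ν.singularPart ω).real univ) + b * ω.real univ := by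
    rw [integral_add (hρi.const_mul a) (integrable_const b), integral_const_mul,
      Measure.integral_toReal_rnDeriv']
    simp [mul_comm]
  have hs : ((ν.singularPart ω univ : ℝ≥0∞) : EReal)
      = (((ν.singularPart ω).real univ : ℝ) : EReal) :=
    (EReal.coe_ennreal_toReal (measure_ne_top _ _)).symm
  have hsing : (c + a) * ((ν.singularPart ω univ : ℝ≥0∞) : EReal)
      = ((c.toENNReal * ν.singularPart ω univ : ℝ≥0∞) : EReal)
        + ((a * (ν.singularPart ω).real univ : ℝ) : EReal) := by
    rw [EReal.coe_ennreal_mul, EReal.coe_toENNReal hc0, hs,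
      EReal.right_distrib_of_nonneg_of_ne_top (EReal.coe_nonneg.2 measureReal_nonneg)
        (EReal.coe_ne_top _), EReal.coe_mul]
  rw [Uomega, hlin, hℓ, hsing, EReal.coe_ennreal_add, add_add_add_comm, ← EReal.coe_add]
  congr 2
  ring

/-- On a compact metric space `X` with finite Borel reference measure `ω`, for a
continuous convex `h : [0,∞) → ℝ` with `h(0) = 0` and `h'(∞) = lim_{r→∞} h(r)/r ∈ (-∞,∞]`,
the internal-energy functional `μ ↦ ∫ h(dμ/dω) dω + h'(∞)·μˢ(X)` is lower semicontinuous
with respect to weak convergence of probability measures. -/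
theorem stmt18 {X : Type*} [MeasurableSpace X] [MetricSpace X] [CompactSpace X]
    [BorelSpace X]
    (ω : Measure X) [IsFiniteMeasure ω]
    (h : ℝ → ℝ)
    (hc : ContinuousOn h (Set.Ici 0))
    (hconv : ConvexOn ℝ (Set.Ici 0) h)
    (h0 : h 0 = 0)
    (hInf : EReal) (hInfbot : hInf ≠ ⊥)
    (hlim : Filter.Tendsto (fun r : ℝ => ((h r / r : ℝ) : EReal)) Filter.atTop
      (nhds hInf))
    (μ : ProbabilityMeasure X) (μs : ℕ → ProbabilityMeasure X)
    (hweak : Filter.Tendsto μs Filter.atTop (nhds μ)) :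
    Uomega ω h hInf (μ : Measure X) ≤
      Filter.liminf (fun i => Uomega ω h hInf (μs i : Measure X)) Filter.atTop := by
  obtain ⟨a, b, hab⟩ : ∃ a b : ℝ, ∀ r, 0 ≤ r → a * r + b ≤ h r :=
    hconv.exists_affine_le_real isClosed_Ici hc.lowerSemicontinuousOn
  have hadd : hInf + ((-a : ℝ) : EReal) + (a : EReal) = hInf := by
    rw [add_assoc, ← EReal.coe_add, neg_add_cancel, EReal.coe_zero, add_zero]
  have hc0 : 0 ≤ hInf + ((-a : ℝ) : EReal) := by
    have h1 := add_le_add_left (coe_slope_le_of_affine_le hlim hab) ((-a : ℝ) : EReal)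
    rwa [← EReal.coe_add, add_neg_cancel, EReal.coe_zero] at h1
  have hlim' : Tendsto (fun r : ℝ => (((h r - (a * r + b)) / r : ℝ) : EReal)) atTop
      (nhds (hInf + ((-a : ℝ) : EReal))) := by
    have h1 : Tendsto (fun r : ℝ => -a - b / r) atTop (nhds (-a - 0)) :=
      tendsto_const_nhds.sub (tendsto_id.const_div_atTop b)
    rw [sub_zero] at h1
    have h2 : Tendsto (fun r : ℝ => ((h r / r : ℝ) : EReal) + ((-a - b / r : ℝ) : EReal)) atTop
        (nhds (hInf + ((-a : ℝ) : EReal))) :=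
      (EReal.continuousAt_add (p := (hInf, ((-a : ℝ) : EReal))) (Or.inr (EReal.coe_ne_bot _))
        (Or.inr (EReal.coe_ne_top _))).tendsto.comp
          (hlim.prodMk_nhds ((continuous_coe_real_ereal.tendsto _).comp h1))
    refine h2.congr' ?_
    filter_upwards [eventually_gt_atTop 0] with r hr
    rw [← EReal.coe_add]
    congr 1
    field_simp
    ring
  have hconv' : ConvexOn ℝ (Ici 0) fun r => h r - (a * r + b) := by
    refine hconv.sub ⟨convex_Ici 0, fun x _ y _ s t _ _ hst => ?_⟩
    simp only [smul_eq_mul]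
    have : b = s * b + t * b := by rw [← add_mul, hst, one_mul]
    linarith
  have hmain := lintegral_add_singularPart_le_liminf ω (hc.sub (by fun_prop)) hconv'
    (fun r hr => sub_nonneg.2 (hab r hr)) hlim' hweak
  have hU (ν : ProbabilityMeasure X) :=
    Uomega_eq_add_coe ω (ν : Measure X) hc hc0 hab
  simp only [hadd] at hU
  simp only [hU]
  have hmono : Monotone fun y : ℝ≥0∞ =>
      (y : EReal) + ((a + b * ω.real univ : ℝ) : EReal) := fun y z hyz =>
    add_le_add_left (EReal.coe_ennreal_le_coe_ennreal_iff.2 hyz) _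
  have hcont : Continuous fun y : ℝ≥0∞ =>
      (y : EReal) + ((a + b * ω.real univ : ℝ) : EReal) := by
    refine continuous_iff_continuousAt.2 fun y => ?_
    exact (EReal.continuousAt_add (p := ((y : EReal), ((a + b * ω.real univ : ℝ) : EReal)))
      (Or.inr (EReal.coe_ne_bot _)) (Or.inr (EReal.coe_ne_top _))).comp
        (f := fun y : ℝ≥0∞ => ((y : EReal), ((a + b * ω.real univ : ℝ) : EReal)))
        (continuous_coe_ennreal_ereal.continuousAt.prodMk continuousAt_const)
  refine (hmono hmain).trans_eq ?_
  exact hmono.map_liminf_of_continuousAt _ hcont.continuousAt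
end
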